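/- Let μ be a (positive) measure on (0,∞) and let f : (0,∞) → ℝ be given by f(x) = ∫_(0,∞) exp(-x·t) dμ(t), where this integral is finite for every x > 0. Then for all a, b > 0, f(a+b) - f(a) - f(b) ≤ f(2√(ab)) - 2·f(√(ab)). -/

import Mathlib

open MeasureTheory

lemma aux_slope {x y : ℝ} (hx : 0 < x) (hxy : x ≤ y) :
    y / (Real.exp y - 1) ≤ x / (Real.exp x - 1) := by
  have hy : 0 < y := hx.trans_le hxy
  have h := convexOn_exp.secant_mono (Set.mem_univ 0) (Set.mem_univ x) (Set.mem_univ y)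
    hx.ne' hy.ne' hxy
  simp only [Real.exp_zero, sub_zero] at h
  have h1 : 0 < Real.exp x - 1 := by linarith [Real.add_one_lt_exp hx.ne']
  have h2 : 0 < Real.exp y - 1 := by linarith [Real.add_one_lt_exp hy.ne']
  rw [div_le_div_iff₀ hx hy] at h
  rw [div_le_div_iff₀ h2 h1]
  linarith

lemma aux_pos {x : ℝ} (hx : 0 < x) : 0 < 1 - Real.exp (-x) := by
  have : Real.exp (-x) < 1 := by
    rw [← Real.exp_zero]; exact Real.exp_lt_exp.2 (by linarith)
  linarith

lemma aux_deriv (u : ℝ) : HasDerivAt (fun u => Real.log (1 - Real.exp (-Real.exp u)))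
    (Real.exp u / (Real.exp (Real.exp u) - 1)) u := by
  have hp := aux_pos (Real.exp_pos u)
  have h1 : 0 < Real.exp (Real.exp u) - 1 := by
    linarith [Real.add_one_lt_exp (Real.exp_pos u).ne', Real.exp_pos u]
  have h0 : HasDerivAt (fun u => -Real.exp u) (-Real.exp u) u := (Real.hasDerivAt_exp u).neg
  refine ((h0.exp.const_sub 1).log hp.ne').congr_deriv ?_
  symm
  rw [div_eq_div_iff h1.ne' hp.ne']
  have h3 : Real.exp (-Real.exp u) * Real.exp (Real.exp u) = 1 := by
    rw [← Real.exp_add]; simp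
  linear_combination (-Real.exp u) * h3

lemma aux_concave :
    ConcaveOn ℝ Set.univ (fun u => Real.log (1 - Real.exp (-Real.exp u))) := by
  apply Antitone.concaveOn_univ_of_deriv
  · exact fun u => (aux_deriv u).differentiableAt
  · intro u v huv
    rw [(aux_deriv u).deriv, (aux_deriv v).deriv]
    exact aux_slope (Real.exp_pos u) (Real.exp_le_exp.2 huv)

lemma aux_point {A B s : ℝ} (hA : 0 < A) (hB : 0 < B) (hs : 0 < s) (h : s * s = A * B) :
    (1 - Real.exp (-A)) * (1 - Real.exp (-B)) ≤ (1 - Real.exp (-s)) ^ 2 := by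
  have hc := aux_concave.2 (Set.mem_univ (Real.log A)) (Set.mem_univ (Real.log B))
    (by norm_num : (0:ℝ) ≤ 1/2) (by norm_num : (0:ℝ) ≤ 1/2) (by norm_num)
  have hl : (1/2:ℝ) • Real.log A + (1/2:ℝ) • Real.log B = Real.log s := by
    have := congrArg Real.log h
    rw [Real.log_mul hs.ne' hs.ne', Real.log_mul hA.ne' hB.ne'] at this
    simp only [smul_eq_mul]; linarith
  rw [hl] at hc
  simp only [Real.exp_log hA, Real.exp_log hB, Real.exp_log hs, smul_eq_mul] at hc
  have pA := aux_pos hA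
  have pB := aux_pos hB
  have ps := aux_pos hs
  rw [← Real.log_le_log_iff (mul_pos pA pB) (pow_pos ps 2), Real.log_mul pA.ne' pB.ne',
    Real.log_pow]
  push_cast
  linarith

/-- If `f` is a bare completely monotone function, i.e.
`f x = ∫_(0,∞) exp(-x·t) dμ(t)` for a positive measure `μ` on `(0,∞)`
(the integral being finite for every `x > 0`), then for all `a, b > 0`,
`f(a+b) - f(a) - f(b) ≤ f(2√(ab)) - 2·f(√(ab))`. -/
theorem cm0_kernel_inequality (μ : Measure ℝ) (f : ℝ → ℝ)
    (hint : ∀ x > 0, IntegrableOn (fun t => Real.exp (-(x * t))) (Set.Ioi 0) μ)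
    (hf : ∀ x > 0, f x = ∫ t in Set.Ioi (0 : ℝ), Real.exp (-(x * t)) ∂μ)
    (a b : ℝ) (ha : 0 < a) (hb : 0 < b) :
    f (a + b) - f a - f b ≤ f (2 * Real.sqrt (a * b)) - 2 * f (Real.sqrt (a * b)) := by
  have hs : 0 < Real.sqrt (a * b) := Real.sqrt_pos.2 (mul_pos ha hb)
  have hss : Real.sqrt (a * b) * Real.sqrt (a * b) = a * b :=
    Real.mul_self_sqrt (mul_pos ha hb).le
  generalize Real.sqrt (a * b) = s at hs hss
  have i1 := hint (a + b) (by positivity)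
  have i2 := hint a ha
  have i3 := hint b hb
  have i4 := hint (2 * s) (by positivity)
  have i5 := hint s hs
  unfold IntegrableOn at i1 i2 i3 i4 i5
  have i12 : Integrable (fun t => Real.exp (-((a + b) * t)) - Real.exp (-(a * t)))
    (μ.restrict (Set.Ioi 0)) := i1.sub i2
  rw [hf (a + b) (by positivity), hf a ha, hf b hb, hf (2 * s) (by positivity), hf s hs,
    ← integral_sub i1 i2, ← integral_sub i12 i3, ← integral_const_mul,
    ← integral_sub i4 (i5.const_mul 2)]
  refine setIntegral_mono_on (i12.sub i3) (i4.sub (i5.const_mul 2))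
    measurableSet_Ioi ?_
  intro t ht
  have ht : 0 < t := ht
  have h := aux_point (mul_pos ha ht) (mul_pos hb ht) (mul_pos hs ht)
    (by linear_combination t ^ 2 * hss)
  have e1 : Real.exp (-((a + b) * t)) = Real.exp (-(a * t)) * Real.exp (-(b * t)) := by
    rw [← Real.exp_add]; ring_nf
  have e2 : Real.exp (-(2 * s * t)) = Real.exp (-(s * t)) * Real.exp (-(s * t)) := by
    rw [← Real.exp_add]; ring_nf
  simp only [e1, e2]
  linarith
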